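/- Let α ∈ ℝ, α ≠ 0, and set E₁ := −exp(4π/α). If E ∈ ℝ with E₁ < E < 0, then for every λ ∈ ℂ\{0}: d(k_E(λ)) := 1 − (α/(2π))·ln(|Re k_E(λ)| + |Im k_E(λ)|) = 0 if and only if |λ| = √(E/E₁) or |λ| = √(E₁/E) (note 0 < E/E₁ < 1 < E₁/E since E₁ < E < 0). Hence the Faddeev generalized scattering data a(k_E(λ)) = b(k_E(λ)) = (2π)⁻²·α/d(k_E(λ)) are singular in λ exactly on the two circles {|λ| = √(E/E₁)} ∪ {|λ| = √(E₁/E)} and are continuous elsewhere on (ℂ ∪ {∞})\{0}. -/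

import Mathlib

/-- The principal square root of a real number, viewed in `ℂ`
(so `√E = i√(−E)` for `E < 0`). -/
noncomputable def sqrtC (E : ℝ) : ℂ := (E : ℂ) ^ (1/2 : ℂ)

/-- The rational parametrization `k_E(λ) = ((λ + λ⁻¹)√E/2, i(λ⁻¹ − λ)√E/2) ∈ ℂ²`
of the fixed-energy surface `{k ∈ ℂ² : k² = E}`. -/
noncomputable def kE (E : ℝ) (lam : ℂ) : ℂ × ℂ :=
  ((lam + lam⁻¹) * sqrtC E / 2, Complex.I * (lam⁻¹ - lam) * sqrtC E / 2)

/-- Euclidean norm `|Re k|` of the componentwise real part of `k ∈ ℂ²`. -/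
noncomputable def normRe (k : ℂ × ℂ) : ℝ := Real.sqrt (k.1.re ^ 2 + k.2.re ^ 2)

/-- Euclidean norm `|Im k|` of the componentwise imaginary part of `k ∈ ℂ²`. -/
noncomputable def normIm (k : ℂ × ℂ) : ℝ := Real.sqrt (k.1.im ^ 2 + k.2.im ^ 2)

/-- The denominator `d(k) = 1 − (α/2π)·ln(|Re k| + |Im k|)` of the Faddeev generalized
scattering data `a(k) = b(k) = (2π)⁻²·α/d(k)` of the 2D point potential of strength `α`. -/
noncomputable def dFad (α : ℝ) (k : ℂ × ℂ) : ℝ :=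
  1 - α / (2 * Real.pi) * Real.log (normRe k + normIm k)

theorem aux_sqrtC (s : ℝ) (hs : 0 < s) : sqrtC (-(s ^ 2)) = Complex.I * s := by
  have h : ((-(s ^ 2) : ℝ) : ℂ) = (Complex.I * s) ^ 2 := by
    rw [mul_pow, Complex.I_sq]; push_cast; ring
  unfold sqrtC
  rw [h]
  have harg : Complex.arg (Complex.I * s) = Real.pi / 2 := by
    rw [mul_comm, Complex.arg_real_mul _ hs, Complex.arg_I]
  have := Complex.pow_cpow_nat_inv (x := Complex.I * s) (n := 2) (by norm_num)
    (by rw [harg]; have := Real.pi_pos; push_cast; linarith)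
    (by rw [harg]; push_cast; exact le_rfl)
  simpa using this

theorem aux_sum (s : ℝ) (hs : 0 < s) (lam : ℂ) (hl : lam ≠ 0) :
    normRe (kE (-(s ^ 2)) lam) + normIm (kE (-(s ^ 2)) lam) =
      s * (|‖lam‖ - ‖lam‖⁻¹| + (‖lam‖ + ‖lam‖⁻¹)) / 2 := by
  have hr : 0 < ‖lam‖ := norm_pos_iff.mpr hl
  have hn : Complex.normSq lam = ‖lam‖ ^ 2 := Complex.normSq_eq_norm_sq lam
  have hxy : lam.re ^ 2 + lam.im ^ 2 = ‖lam‖ ^ 2 := by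
    rw [← hn, Complex.normSq_apply]; ring
  have e1 : normRe (kE (-(s ^ 2)) lam) = s * |‖lam‖ - ‖lam‖⁻¹| / 2 := by
    unfold normRe
    rw [Real.sqrt_eq_iff_mul_self_eq (by positivity) (by positivity)]
    simp [kE, aux_sqrtC s hs, hn]
    generalize ‖lam‖ = r at *
    rw [show s * |r - r⁻¹| / 2 * (s * |r - r⁻¹| / 2) = s ^ 2 / 4 * |r - r⁻¹| ^ 2 by ring, sq_abs]
    trans s ^ 2 / 4 * ((lam.re ^ 2 + lam.im ^ 2) * (1 - (r ^ 2)⁻¹) ^ 2)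
    · field_simp; ring
    · rw [hxy]; field_simp
  have e2 : normIm (kE (-(s ^ 2)) lam) = s * (‖lam‖ + ‖lam‖⁻¹) / 2 := by
    unfold normIm
    rw [Real.sqrt_eq_iff_mul_self_eq (by positivity) (by positivity)]
    simp [kE, aux_sqrtC s hs, hn]
    generalize ‖lam‖ = r at *
    trans s ^ 2 / 4 * ((lam.re ^ 2 + lam.im ^ 2) * (1 + (r ^ 2)⁻¹) ^ 2)
    · field_simp; ring
    · rw [hxy]; field_simp; norm_num
  rw [e1, e2]; ring

theorem aux_circ (s T r : ℝ) (hs : 0 < s) (hT : s < T) (hr : 0 < r) :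
    s * (|r - r⁻¹| + (r + r⁻¹)) / 2 = T ↔ r = s / T ∨ r = T / s := by
  have hT0 : 0 < T := hs.trans hT
  rcases le_total 1 r with h | h
  · have hi : r⁻¹ ≤ 1 := inv_le_one_of_one_le₀ h
    rw [abs_of_nonneg (by linarith)]
    have h1 : s / T < 1 := (div_lt_one hT0).2 hT
    rw [show s * (r - r⁻¹ + (r + r⁻¹)) / 2 = r * s by ring, ← eq_div_iff hs.ne']
    constructor
    · exact Or.inr
    · rintro (h2 | h2)
      · linarith
      · exact h2
  · have hi : 1 ≤ r⁻¹ := (one_le_inv₀ hr).2 h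
    rw [abs_of_nonpos (by linarith)]
    have h1 : 1 < T / s := (one_lt_div hs).2 hT
    rw [show s * (-(r - r⁻¹) + (r + r⁻¹)) / 2 = s / r by ring, div_eq_iff hr.ne',
      eq_div_iff hT0.ne']
    constructor
    · intro h2; left; linarith
    · rintro (h2 | h2)
      · linarith
      · linarith

/-- Let `α ≠ 0`, `E₁ := −exp(4π/α)`, and `E₁ < E < 0`. Then for every `λ ∈ ℂ\{0}`:
`d(k_E(λ)) = 0 ↔ |λ| = √(E/E₁)` or `|λ| = √(E₁/E)`; hence the Faddeev generalized
scattering data `(2π)⁻²·α/d(k_E(λ))` are singular exactly on these two circles and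
continuous elsewhere on `ℂ\{0}`. -/
theorem point_potential_data_contour_singularities_negative_energy
    (α : ℝ) (hα : α ≠ 0) (E : ℝ)
    (hE₁ : -Real.exp (4 * Real.pi / α) < E) (hE₀ : E < 0) :
    (∀ lam : ℂ, lam ≠ 0 →
      (dFad α (kE E lam) = 0 ↔
        ‖lam‖ = Real.sqrt (E / (-Real.exp (4 * Real.pi / α))) ∨
        ‖lam‖ = Real.sqrt ((-Real.exp (4 * Real.pi / α)) / E))) ∧
    ContinuousOn (fun lam : ℂ => ((2 * Real.pi) ^ 2)⁻¹ * α / dFad α (kE E lam))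
      {lam : ℂ | lam ≠ 0 ∧
        ‖lam‖ ≠ Real.sqrt (E / (-Real.exp (4 * Real.pi / α))) ∧
        ‖lam‖ ≠ Real.sqrt ((-Real.exp (4 * Real.pi / α)) / E)} := by
  obtain ⟨s, hs, rfl⟩ : ∃ s : ℝ, 0 < s ∧ E = -(s ^ 2) :=
    ⟨Real.sqrt (-E), Real.sqrt_pos.2 (by linarith), by rw [Real.sq_sqrt (by linarith)]; ring⟩
  obtain ⟨T, hTdef⟩ : ∃ T : ℝ, T = Real.exp (2 * Real.pi / α) := ⟨_, rfl⟩
  have hT0 : 0 < T := hTdef ▸ Real.exp_pos _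
  have hT2 : Real.exp (4 * Real.pi / α) = T ^ 2 := by
    rw [hTdef, ← Real.exp_nat_mul]; congr 1; push_cast; ring
  rw [hT2] at hE₁ ⊢
  have hsT : s < T := by
    apply lt_of_pow_lt_pow_left₀ 2 hT0.le; linarith
  have q1 : Real.sqrt (-(s ^ 2) / -(T ^ 2)) = s / T := by
    rw [neg_div_neg_eq, ← div_pow, Real.sqrt_sq (by positivity)]
  have q2 : Real.sqrt (-(T ^ 2) / -(s ^ 2)) = T / s := by
    rw [neg_div_neg_eq, ← div_pow, Real.sqrt_sq (by positivity)]
  rw [q1, q2]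
  have hpos : ∀ lam : ℂ, lam ≠ 0 →
      0 < s * (|‖lam‖ - ‖lam‖⁻¹| + (‖lam‖ + ‖lam‖⁻¹)) / 2 := by
    intro lam hl
    have hr : 0 < ‖lam‖ := norm_pos_iff.mpr hl
    positivity
  have key : ∀ lam : ℂ, lam ≠ 0 →
      (dFad α (kE (-(s ^ 2)) lam) = 0 ↔ ‖lam‖ = s / T ∨ ‖lam‖ = T / s) := by
    intro lam hl
    rw [← aux_circ s T _ hs hsT (norm_pos_iff.mpr hl)]
    unfold dFad
    rw [aux_sum s hs lam hl]
    have hp := hpos lam hl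
    generalize s * (|‖lam‖ - ‖lam‖⁻¹| + (‖lam‖ + ‖lam‖⁻¹)) / 2 = S at *
    have hpi := Real.pi_pos
    have : 1 - α / (2 * Real.pi) * Real.log S = 0 ↔ Real.log S = 2 * Real.pi / α := by
      constructor
      · intro h
        field_simp at h ⊢
        linarith
      · intro h
        rw [h]; field_simp; ring
    rw [this, hTdef]
    constructor
    · intro h; rw [← h, Real.exp_log hp]
    · intro h; rw [h, Real.log_exp]
  refine ⟨key, ?_⟩
  apply ContinuousOn.div continuousOn_const
  · have : ContinuousOn (fun lam : ℂ => 1 - α / (2 * Real.pi) *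
        Real.log (s * (|‖lam‖ - ‖lam‖⁻¹| + (‖lam‖ + ‖lam‖⁻¹)) / 2))
        {lam : ℂ | lam ≠ 0 ∧ ‖lam‖ ≠ s / T ∧ ‖lam‖ ≠ T / s} := by
      have hinv : ContinuousOn (fun lam : ℂ => ‖lam‖⁻¹)
          {lam : ℂ | lam ≠ 0 ∧ ‖lam‖ ≠ s / T ∧ ‖lam‖ ≠ T / s} :=
        continuous_norm.continuousOn.inv₀ (fun x hx => norm_ne_zero_iff.2 hx.1)
      have hnorm : ContinuousOn (fun lam : ℂ => ‖lam‖)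
          {lam : ℂ | lam ≠ 0 ∧ ‖lam‖ ≠ s / T ∧ ‖lam‖ ≠ T / s} :=
        continuous_norm.continuousOn
      refine continuousOn_const.sub (continuousOn_const.mul (ContinuousOn.log ?_ ?_))
      · exact (continuousOn_const.mul ((hnorm.sub hinv).abs.add (hnorm.add hinv))).div_const 2
      · intro x hx; exact (hpos x hx.1).ne'
    refine this.congr ?_
    intro x hx
    simp only [dFad]
    rw [aux_sum s hs x hx.1]
  · intro x hx h0
    rcases (key x hx.1).1 h0 with h | h
    · exact hx.2.1 h
    · exact hx.2.2 h
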